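/- Let p be a prime, let t ≥ 3 be an integer, and let f : Z/pZ → [0,1] be not identically 0. Let λ_1, ..., λ_p be the Fourier coefficients of f arranged by decreasing absolute value, λ_i = f̂(a_i) with |f̂(a_1)| ≥ ... ≥ |f̂(a_p)|, and let θ = p^{-1} Σ_n f(n). Suppose that for some integer k with 1 ≤ k < (log p)^{t−1} (5t log log p)^{−2t+2} and some real γ ≥ 0 we have |λ_{k+1}| ≤ γ |λ_k| and γ < t^{−1} θ^{−t+2} (|λ_k|/p)^{t−1}. Then the t-fold convolution f*f*...*f (t copies of f) is strictly positive at every point of Z/pZ. -/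

import Mathlib

open Finset

/-- The Fourier transform of `f : ZMod p → ℝ`:
`f̂(a) = ∑ n, f n * e^(2πi a n / p)`, where `a n` is computed from the canonical
integer representatives (the value is well defined modulo `p`). -/
noncomputable def dft (p : ℕ) [NeZero p] (f : ZMod p → ℝ) (a : ZMod p) : ℂ :=
  ∑ n : ZMod p, (f n : ℂ) *
    Complex.exp (2 * Real.pi * Complex.I * ((a.val * n.val : ℕ) : ℂ) / p)

/-- Convolution of real-valued functions on `ZMod p`: `(f*g)(n) = ∑ m, f m * g (n - m)`. -/
def convR (p : ℕ) [NeZero p] (f g : ZMod p → ℝ) (n : ZMod p) : ℝ :=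
  ∑ m : ZMod p, f m * g (n - m)

/-- The `t`-fold convolution of `f` with itself: `iterConv p f 1 = f` (convolution with
the identity `δ₀`), and `iterConv p f (t+1) = f * (iterConv p f t)`. -/
def iterConv (p : ℕ) [NeZero p] (f : ZMod p → ℝ) : ℕ → ZMod p → ℝ
  | 0 => fun n => if n = 0 then 1 else 0
  | t + 1 => convR p f (iterConv p f t)

lemma exists_small_hitting_set {ι α : Type*} [DecidableEq α] (X : Finset α) (hX : X.Nonempty)
    (F : Finset ι) (T : ι → Finset α) (δ : ℝ) (hδ : δ ≤ 1)
    (hTX : ∀ i ∈ F, T i ⊆ X) (hT : ∀ i ∈ F, δ * #X ≤ #(T i)) (s : ℕ) :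
    ∃ S ⊆ X, #S ≤ s ∧ (#{i ∈ F | Disjoint (T i) S} : ℝ) ≤ #F * (1 - δ) ^ s := by
  induction s with
  | zero => exact ⟨∅, by simp, by simp, by simp⟩
  | succ s ih =>
    obtain ⟨S, hSX, hS, hF⟩ := ih
    set G : Finset ι := {i ∈ F | Disjoint (T i) S} with hG
    have hGF : G ⊆ F := filter_subset _ _
    have hsum : ∑ x ∈ X, (δ * #G : ℝ) ≤ ∑ x ∈ X, (#{i ∈ G | x ∈ T i} : ℝ) := by
      have h1 : ∑ x ∈ X, #{i ∈ G | x ∈ T i} = ∑ i ∈ G, #(T i) := by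
        simp only [card_filter]
        rw [sum_comm]
        refine sum_congr rfl fun i hi => ?_
        rw [← card_filter, filter_mem_eq_inter, inter_eq_right.2 (hTX i (hGF hi))]
      have h2 : ∑ i ∈ G, (δ * #X : ℝ) ≤ ∑ i ∈ G, (#(T i) : ℝ) :=
        sum_le_sum fun i hi => hT i (hGF hi)
      rw [← Nat.cast_sum, h1, Nat.cast_sum]
      refine le_trans (le_of_eq ?_) h2
      simp only [sum_const, nsmul_eq_mul]
      ring
    obtain ⟨x, hx, hxG⟩ := exists_le_of_sum_le hX hsum
    refine ⟨insert x S, insert_subset hx hSX, (card_insert_le _ _).trans (by omega), ?_⟩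
    have h3 : ({i ∈ F | Disjoint (T i) (insert x S)} : Finset ι) = {i ∈ G | x ∉ T i} := by
      ext i
      simp only [mem_filter, hG, disjoint_insert_right]
      tauto
    have h4 := card_filter_add_card_filter_not (s := G) (fun i => x ∈ T i)
    have h5 : (#{i ∈ G | x ∈ T i} : ℝ) + #{i ∈ G | x ∉ T i} = #G := by exact_mod_cast h4
    rw [h3, pow_succ]
    have h6 := mul_le_mul_of_nonneg_right hF (sub_nonneg.2 hδ)
    nlinarith

lemma exists_dilation {p : ℕ} [Fact p.Prime] (S : Finset (ZMod p)) (Q : ℕ) (hQ : 0 < Q)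
    (h : Q ^ #S < p) :
    ∃ d : ZMod p, d ≠ 0 ∧ ∃ m : ZMod p → ℤ,
      ∀ x ∈ S, (m x : ZMod p) = d * x ∧ |m x| * Q < p := by
  classical
  have hp : 0 < p := (Fact.out : p.Prime).pos
  let φ : ZMod p → (S → Fin Q) := fun d x =>
    ⟨(d * x.1).val * Q / p, by
      rw [Nat.div_lt_iff_lt_mul hp, mul_comm]
      exact Nat.mul_lt_mul_of_pos_left (ZMod.val_lt _) hQ⟩
  have hcard : Fintype.card (S → Fin Q) < Fintype.card (ZMod p) := by
    simpa [ZMod.card] using h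
  obtain ⟨d₁, d₂, hne, heq⟩ := Fintype.exists_ne_map_eq_of_card_lt φ hcard
  refine ⟨d₁ - d₂, sub_ne_zero.2 hne, fun x => ((d₁ * x).val : ℤ) - (d₂ * x).val, fun x hx => ?_⟩
  refine ⟨by simp [sub_mul], ?_⟩
  have h1 : (d₁ * x).val * Q / p = (d₂ * x).val * Q / p := by
    have := congrFun heq ⟨x, hx⟩
    simpa [φ] using this
  have e1 := Nat.div_add_mod ((d₁ * x).val * Q) p
  have e2 := Nat.div_add_mod ((d₂ * x).val * Q) p
  have l1 := Nat.mod_lt ((d₁ * x).val * Q) hp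
  have l2 := Nat.mod_lt ((d₂ * x).val * Q) hp
  rw [h1] at e1
  have hQ' : |(Q : ℤ)| = Q := abs_of_nonneg (by positivity)
  rw [← hQ', ← abs_mul, abs_lt, sub_mul]
  generalize (d₁ * x).val * Q % p = r₁ at *
  generalize (d₂ * x).val * Q % p = r₂ at *
  have n1 : 0 ≤ (r₁ : ℤ) := by positivity
  have n2 : 0 ≤ (r₂ : ℤ) := by positivity
  constructor <;> zify at e1 e2 l1 l2 <;> linarith

lemma exists_few_representations {p : ℕ} [Fact p.Prime] (X B : Finset (ZMod p))
    (hX : X.Nonempty) (hB : B.Nonempty) (K : ℕ) (hXK : #X ≤ K) (hBK : #B ≤ K)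
    (L : ℝ) (hL : 1 ≤ L) (s : ℕ) (hs : (K : ℝ) ^ 2 * Real.exp (-(s / (2 * L))) < 1)
    (hp : (2 * K) ^ s < p) :
    ∃ c : ZMod p, ({x ∈ X | x + c ∈ B} : Finset (ZMod p)).Nonempty ∧
      (#{x ∈ X | x + c ∈ B} : ℝ) ≤ max 1 (#X / L) := by
  classical
  by_contra! hcon
  have hK : 0 < K := hB.card_pos.trans_le hBK
  let T : ZMod p × ZMod p → Finset (ZMod p) := fun q =>
    ({x ∈ X | x + (q.1 - q.2) ∈ B} : Finset (ZMod p)).erase q.2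
  have hT : ∀ q ∈ B ×ˢ X, 1 / (2 * L) * #X ≤ #(T q) := by
    rintro ⟨b, x⟩ hq
    obtain ⟨hb, hx⟩ := mem_product.1 hq
    have hmem : x ∈ ({y ∈ X | y + (b - x) ∈ B} : Finset (ZMod p)) := by
      simpa [hx] using hb
    have h1 := hcon (b - x) ⟨x, hmem⟩
    obtain ⟨h2, h3⟩ := max_lt_iff.1 h1
    have h4 := card_erase_add_one hmem
    have h5 : (#(T (b, x)) : ℝ) + 1 = #{y ∈ X | y + (b - x) ∈ B} := by exact_mod_cast h4
    have h6 : 2 ≤ #{y ∈ X | y + (b - x) ∈ B} := by exact_mod_cast h2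
    have h7 : (2 : ℝ) ≤ #{y ∈ X | y + (b - x) ∈ B} := by exact_mod_cast h6
    have h8 : 1 / (2 * L) * (#X : ℝ) = (#X / L) / 2 := by field_simp
    rw [h8]
    linarith
  have hδ : 1 / (2 * L) ≤ 1 := by
    rw [div_le_one (by linarith)]; linarith
  obtain ⟨S, hSX, hSs, hmiss⟩ := exists_small_hitting_set X hX (B ×ˢ X) T (1 / (2 * L)) hδ
    (fun q _ => (erase_subset _ _).trans (filter_subset _ _)) hT s
  have hzero : #{q ∈ B ×ˢ X | Disjoint (T q) S} = 0 := by
    rw [← Nat.lt_one_iff, ← Nat.cast_lt (α := ℝ), Nat.cast_one]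
    refine lt_of_le_of_lt (hmiss.trans ?_) hs
    refine mul_le_mul ?_ ?_ (pow_nonneg (sub_nonneg.2 hδ) _) (by positivity)
    · rw [card_product, sq]
      exact_mod_cast Nat.mul_le_mul hBK hXK
    · calc (1 - 1 / (2 * L)) ^ s ≤ (Real.exp (-(1 / (2 * L)))) ^ s := by
            refine pow_le_pow_left₀ (sub_nonneg.2 hδ) ?_ _
            have := Real.add_one_le_exp (-(1 / (2 * L)))
            linarith
        _ = Real.exp (-(s / (2 * L))) := by
            rw [← Real.exp_nat_mul]; congr 1; ring
  have hhit : ∀ b ∈ B, ∀ x ∈ X, ∃ y ∈ S, y ≠ x ∧ y + (b - x) ∈ B := by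
    intro b hb x hx
    have h1 : ¬ Disjoint (T (b, x)) S := fun h => by
      have := (card_eq_zero.1 hzero).subset (mem_filter.2 ⟨mk_mem_product hb hx, h⟩)
      simp at this
    obtain ⟨y, hy, hyS⟩ := not_disjoint_iff.1 h1
    obtain ⟨hne, hy⟩ := mem_erase.1 hy
    exact ⟨y, hyS, hne, (mem_filter.1 hy).2⟩
  obtain ⟨b₀, hb₀⟩ := hB
  have hSne : S.Nonempty := by
    obtain ⟨x, hx⟩ := hX
    obtain ⟨y, hy, -⟩ := hhit b₀ hb₀ x hx
    exact ⟨y, hy⟩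
  obtain ⟨d, hd, m, hm⟩ := exists_dilation S (2 * K) (by positivity)
    ((Nat.pow_le_pow_right (by positivity) hSs).trans_lt hp)
  obtain ⟨z, hz, hzmax⟩ := exists_max_image S m hSne
  have hstep : ∀ b : B, ∃ b' : B, ∃ δ : ℤ, 0 < δ ∧ δ * K < p ∧
      d * (b' : ZMod p) = d * b - δ := by
    rintro ⟨b, hb⟩
    obtain ⟨y, hy, hyz, hyb⟩ := hhit b hb z (hSX hz)
    refine ⟨⟨_, hyb⟩, m z - m y, ?_, ?_, ?_⟩
    · refine sub_pos.2 (lt_of_le_of_ne (hzmax y hy) fun h => hyz ?_)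
      refine mul_left_cancel₀ hd ?_
      rw [← (hm y hy).1, ← (hm z hz).1, h]
    · have h1 := (hm z hz).2
      have h2 := (hm y hy).2
      have h3 := mul_le_mul_of_nonneg_right (le_abs_self (m z)) (by positivity : (0:ℤ) ≤ K)
      have h4 := mul_le_mul_of_nonneg_right (neg_abs_le (m y)) (by positivity : (0:ℤ) ≤ K)
      push_cast at h1 h2
      linarith
    · push_cast
      rw [(hm z hz).1, (hm y hy).1]
      ring
  choose g δ hδpos hδlt hg using hstep
  have hiter : ∀ (b : B) (n : ℕ), 0 < n → ∃ D : ℤ, 0 < D ∧ D * K < n * p ∧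
      d * ((g^[n] b : B) : ZMod p) = d * b - D := by
    intro b n hn
    induction n, hn using Nat.le_induction with
    | base => exact ⟨δ b, hδpos b, by simpa using hδlt b, by simpa using hg b⟩
    | succ n hn ih =>
      obtain ⟨D, h1, h2, h3⟩ := ih
      refine ⟨D + δ (g^[n] b), by have := hδpos (g^[n] b); omega, ?_, ?_⟩
      · have := hδlt (g^[n] b)
        push_cast
        linarith
      · rw [Function.iterate_succ_apply', hg, h3]
        push_cast
        ring
  obtain ⟨i, j, hij, heq⟩ := Fintype.exists_ne_map_eq_of_card_lt
    (fun i : Fin (K + 1) => g^[(i : ℕ)] ⟨b₀, hb₀⟩) (by simpa using Nat.lt_succ_of_le hBK)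
  wlog hlt : i < j generalizing i j
  · exact this j i hij.symm heq.symm (lt_of_le_of_ne (not_lt.1 hlt) hij.symm)
  have hlt' : (i : ℕ) < j := hlt
  obtain ⟨D, h1, h2, h3⟩ := hiter (g^[(i : ℕ)] ⟨b₀, hb₀⟩) (j - i) (by omega)
  rw [← Function.iterate_add_apply, Nat.sub_add_cancel hlt'.le] at h3
  have heq' : g^[(i : ℕ)] ⟨b₀, hb₀⟩ = g^[(j : ℕ)] ⟨b₀, hb₀⟩ := heq
  rw [← heq'] at h3
  have hD : (D : ZMod p) = 0 := by
    have : d * ((g^[(i : ℕ)] ⟨b₀, hb₀⟩ : B) : ZMod p) -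
      d * ((g^[(i : ℕ)] ⟨b₀, hb₀⟩ : B) : ZMod p) = -D := by
        nth_rewrite 1 [h3]; ring
    simpa using this.symm
  have hdvd := Int.le_of_dvd h1 ((ZMod.intCast_zmod_eq_zero_iff_dvd D p).1 hD)
  have hji : ((j - i : ℕ) : ℤ) ≤ K := by have := j.2; omega
  have hp0 : (0 : ℤ) ≤ p := by positivity
  have h5 := mul_le_mul_of_nonneg_right hji hp0
  have h6 := mul_le_mul_of_nonneg_right hdvd (by positivity : (0 : ℤ) ≤ K)
  nlinarith

lemma exists_unique_translate {p : ℕ} [Fact p.Prime] (B : Finset (ZMod p)) (hB : B.Nonempty)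
    (L : ℝ) (hL : 1 ≤ L) (s : ℕ) (hs : (#B : ℝ) ^ 2 * Real.exp (-(s / (2 * L))) < 1)
    (hp : (2 * #B) ^ s < p) (r : ℕ) (hr : (#B : ℝ) ≤ L ^ r) :
    ∃ (u : Fin (r + 1) → ZMod p) (a₀ : ZMod p), ∀ a, (∀ i, a + u i ∈ B) ↔ a = a₀ := by
  classical
  have key : ∀ j : ℕ, ∃ (u : Fin (j + 1) → ZMod p),
      (univ.filter fun a => ∀ i, a + u i ∈ B).Nonempty ∧
      (#(univ.filter fun a => ∀ i, a + u i ∈ B) : ℝ) ≤ max 1 (#B / L ^ j) := by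
    intro j
    induction j with
    | zero => exact ⟨0, by simpa using hB, by simp⟩
    | succ j ih =>
      obtain ⟨u, hne, hcard⟩ := ih
      set X := univ.filter fun a => ∀ i, a + u i ∈ B with hX
      have hXB : #X ≤ #B :=
        card_le_card_of_injOn (· + u 0) (fun a ha => (mem_filter.1 ha).2 0)
          ((add_left_injective _).injOn)
      obtain ⟨c, hc, hcc⟩ :=
        exists_few_representations X B hne hB #B hXB le_rfl L hL s hs hp
      have hEq : (univ.filter fun a => ∀ i, a + (Fin.cons c u : Fin (j + 2) → ZMod p) i ∈ B)
          = {x ∈ X | x + c ∈ B} := by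
        ext a
        simp only [hX, mem_filter, mem_univ, true_and, Fin.forall_fin_succ (n := j + 1),
          Fin.cons_zero, Fin.cons_succ]
        tauto
      refine ⟨Fin.cons c u, hEq ▸ hc, ?_⟩
      rw [hEq]
      refine hcc.trans (max_le (le_max_left _ _) ?_)
      have hL0 : 0 < L := by linarith
      refine (div_le_div_of_nonneg_right hcard hL0.le).trans ?_
      rw [← max_div_div_right hL0.le, div_div, ← pow_succ]
      exact max_le_max ((div_le_one hL0).2 hL) le_rfl
  obtain ⟨u, hne, hcard⟩ := key r
  have hone : max 1 ((#B : ℝ) / L ^ r) = 1 :=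
    max_eq_left ((div_le_one (by positivity)).2 hr)
  rw [hone] at hcard
  have h1 : #(univ.filter fun a => ∀ i, a + u i ∈ B) = 1 :=
    le_antisymm (by exact_mod_cast hcard) hne.card_pos
  obtain ⟨a₀, ha₀⟩ := card_eq_one.1 h1
  refine ⟨u, a₀, fun a => ?_⟩
  have := Finset.ext_iff.1 ha₀ a
  simpa using this

lemma exists_sample_size {p t k : ℕ} (hp : 2 ≤ p) (ht : 3 ≤ t) (hk : 1 ≤ k)
    (L : ℝ) (hLdef : L = Real.log p / (5 * t * Real.log (Real.log p)) ^ 2)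
    (hkL : (k : ℝ) < L ^ (t - 1)) :
    1 ≤ L ∧ ∃ s : ℕ, (k : ℝ) ^ 2 * Real.exp (-(s / (2 * L))) < 1 ∧ (2 * k) ^ s < p := by
  have hk' : (1 : ℝ) ≤ k := by exact_mod_cast hk
  have ht' : (3 : ℝ) ≤ t := by exact_mod_cast ht
  have hp1 : (1 : ℝ) < p := by exact_mod_cast hp
  set y := Real.log p with hy
  have hy0 : 0 < y := Real.log_pos hp1
  set l := Real.log y with hl
  have hL0 : 0 ≤ L := by rw [hLdef]; positivity
  have hL1 : 1 < L := by
    by_contra h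
    have := pow_le_one₀ (n := t - 1) hL0 (not_lt.1 h)
    linarith
  have hden : 0 < (5 * t * l) ^ 2 := by
    rcases (sq_nonneg (5 * t * l)).lt_or_eq with h | h
    · exact h
    · rw [hLdef, ← h] at hL1; norm_num at hL1
  have hmain : (5 * t * l) ^ 2 < y := by
    rw [hLdef, one_lt_div hden] at hL1; exact hL1
  have h225 : 225 * l ^ 2 < y := by
    have : 225 * l ^ 2 ≤ (5 * t * l) ^ 2 := by
      have : (9 : ℝ) ≤ t ^ 2 := by nlinarith
      nlinarith [sq_nonneg l]
    linarith
  have hyl : 196 < y := by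
    have hstep : ∀ a : ℝ, 0 ≤ a → a * y ≤ 15 * (y - 1) → a ^ 2 < y := by
      intro a ha h
      have h1 : a / 15 ≤ l := by
        refine le_trans ?_ (Real.one_sub_inv_le_log_of_pos hy0)
        rw [div_le_iff₀ (by norm_num), ← mul_le_mul_iff_left₀ hy0]
        field_simp
        linarith
      nlinarith
    have hy3 : 1.09 < y := by
      rcases hp.eq_or_lt with rfl | hp3
      · exfalso
        have h2 : y < 0.6931471808 := by simpa [hy] using Real.log_two_lt_d9
        have h3 := Real.log_le_sub_one_of_pos hy0
        nlinarith
      · have h3 : Real.log 3 ≤ y := Real.log_le_log (by norm_num) (by exact_mod_cast hp3)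
        linarith [Real.log_three_gt_d9]
    have h1 := hstep 1.2 (by norm_num) (by linarith)
    have h2 := hstep 4 (by norm_num) (by linarith)
    have h3 := hstep 14 (by norm_num) (by linarith)
    linarith
  have hl1 : 1 ≤ l := by
    rw [hl, Real.le_log_iff_exp_le hy0]
    linarith [Real.exp_one_lt_d9]
  have hLy : L ≤ y := by
    rw [hLdef]
    exact div_le_self hy0.le (one_le_pow₀ (by nlinarith))
  have hlogk : Real.log k ≤ t * l := by
    have h1 : Real.log k ≤ Real.log (y ^ (t - 1)) :=
      Real.log_le_log (by linarith) (hkL.le.trans (pow_le_pow_left₀ hL0 hLy _))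
    rw [Real.log_pow, ← hl] at h1
    have h2 : ((t - 1 : ℕ) : ℝ) ≤ t := by exact_mod_cast Nat.sub_le _ _
    nlinarith
  have hlogk0 : 0 ≤ Real.log k := Real.log_nonneg hk'
  refine ⟨hL1.le, ?_⟩
  rcases hk.eq_or_lt with rfl | hk2
  · refine ⟨1, ?_, ?_⟩
    · simp only [Nat.cast_one, one_pow, one_mul, Real.exp_lt_one_iff, neg_lt_zero]
      positivity
    · have : (2 : ℝ) < p := by
        rw [← Real.log_lt_log_iff (by norm_num) (by linarith)]
        linarith [Real.log_two_lt_d9]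
      simpa using (by exact_mod_cast this : 2 < p)
  refine ⟨⌊4 * L * Real.log k⌋₊ + 1, ?_, ?_⟩
  · have h1 := Nat.lt_floor_add_one (4 * L * Real.log k)
    have h2 : (k : ℝ) ^ 2 = Real.exp (2 * Real.log k) := by
      rw [mul_comm, Real.exp_mul, Real.exp_log (by linarith)]; norm_cast
    rw [h2, ← Real.exp_add, Real.exp_lt_one_iff]
    have h3 : 2 * Real.log k < ((⌊4 * L * Real.log k⌋₊ + 1 : ℕ) : ℝ) / (2 * L) := by
      rw [lt_div_iff₀ (by linarith)]; push_cast; linarith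
    linarith
  · have h1 := Nat.floor_le (by positivity : 0 ≤ 4 * L * Real.log k)
    have h2 : Real.log (2 * k) ≤ 2 * Real.log k := by
      rw [Real.log_mul (by norm_num) (by linarith)]
      have : Real.log 2 ≤ Real.log k := Real.log_le_log (by norm_num) (by exact_mod_cast hk2)
      linarith
    have h3 : L * (25 * (t * l) ^ 2) = y := by
      rw [hLdef]; field_simp; ring
    have h4 : L * Real.log k ^ 2 ≤ L * (t * l) ^ 2 := by gcongr
    have h5 : t * l ≤ y / 5 := by
      have : 25 * (t * l) ^ 2 < y := by nlinarith
      nlinarith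
    suffices h : (((2 * k) ^ (⌊4 * L * Real.log k⌋₊ + 1) : ℕ) : ℝ) < p by exact_mod_cast h
    push_cast
    rw [← Real.log_lt_log_iff (by positivity) (by linarith), Real.log_pow, ← hy]
    push_cast
    calc (⌊4 * L * Real.log k⌋₊ + 1 : ℝ) * Real.log (2 * k)
        ≤ (4 * L * Real.log k + 1) * (2 * Real.log k) := by
          gcongr
          exact Real.log_nonneg (by linarith)
      _ < y := by nlinarith

lemma dft_eq_sum_stdAddChar (p : ℕ) [NeZero p] (f : ZMod p → ℝ) (a : ZMod p) :
    dft p f a = ∑ n, (f n : ℂ) * ZMod.stdAddChar (a * n) := by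
  refine sum_congr rfl fun n _ => ?_
  have h : a * n = (((a.val * n.val : ℕ) : ℤ) : ZMod p) := by simp
  rw [h, ZMod.stdAddChar_coe]
  norm_cast

lemma sum_stdAddChar_mul (p : ℕ) [NeZero p] (b : ZMod p) :
    ∑ a : ZMod p, (ZMod.stdAddChar (a * b) : ℂ) = if b = 0 then (p : ℂ) else 0 := by
  have := AddChar.sum_mulShift b (ZMod.isPrimitive_stdAddChar p)
  rw [this]
  simp [ZMod.card]

lemma norm_stdAddChar (p : ℕ) [NeZero p] (b : ZMod p) : ‖(ZMod.stdAddChar b : ℂ)‖ = 1 := by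
  rw [ZMod.stdAddChar_apply, Circle.norm_coe]

lemma norm_dft_le (p : ℕ) [NeZero p] (f : ZMod p → ℝ) (hf : ∀ n, 0 ≤ f n) (a : ZMod p) :
    ‖dft p f a‖ ≤ ∑ n, f n := by
  rw [dft_eq_sum_stdAddChar]
  refine norm_sum_le_of_le _ fun n _ => ?_
  rw [norm_mul, norm_stdAddChar, mul_one, Complex.norm_real, Real.norm_of_nonneg (hf n)]

lemma sum_norm_dft_sq (p : ℕ) [NeZero p] (f : ZMod p → ℝ) :
    ∑ a, ‖dft p f a‖ ^ 2 = p * ∑ n, f n ^ 2 := by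
  have h : ∀ a, ((‖dft p f a‖ ^ 2 : ℝ) : ℂ) =
      ∑ m, ∑ n, (f m : ℂ) * f n * ZMod.stdAddChar (a * (m - n)) := by
    intro a
    rw [Complex.ofReal_pow, ← Complex.mul_conj', dft_eq_sum_stdAddChar, map_sum, sum_mul_sum]
    refine sum_congr rfl fun m _ => sum_congr rfl fun n _ => ?_
    rw [map_mul (starRingEnd ℂ), Complex.conj_ofReal, ← AddChar.map_neg_eq_conj, mul_sub, sub_eq_add_neg,
      AddChar.map_add_eq_mul]
    ring
  rw [← Complex.ofReal_inj, Complex.ofReal_sum]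
  simp_rw [h]
  rw [sum_comm]
  simp_rw [sum_comm (s := (univ : Finset (ZMod p))) (t := (univ : Finset (ZMod p)))
    (f := fun a n => (f _ : ℂ) * f n * ZMod.stdAddChar (a * (_ - n))), ← mul_sum,
    sum_stdAddChar_mul, sub_eq_zero]
  simp [mul_sum]
  refine sum_congr rfl fun n _ => by ring

lemma norm_sum_prod_dft_le (p : ℕ) [NeZero p] (f : ZMod p → ℝ) (hf : ∀ n, 0 ≤ f n) (s : ℕ)
    (u : Fin s → ZMod p) (n : ZMod p) :
    ‖∑ a, (ZMod.stdAddChar (a * -n) : ℂ) * ∏ i, dft p f (a + u i)‖ ≤ p * iterConv p f s n := by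
  induction s generalizing n with
  | zero =>
    simp only [univ_eq_empty, prod_empty, mul_one, sum_stdAddChar_mul, neg_eq_zero, iterConv]
    split_ifs <;> simp
  | succ s ih =>
    have h : ∑ a, (ZMod.stdAddChar (a * -n) : ℂ) * ∏ i, dft p f (a + u i) =
        ∑ m, (f m : ℂ) * ZMod.stdAddChar (u 0 * m) *
          ∑ a, (ZMod.stdAddChar (a * -(n - m)) : ℂ) * ∏ i : Fin s, dft p f (a + u i.succ) := by
      simp_rw [Fin.prod_univ_succ, dft_eq_sum_stdAddChar p f (_ + u 0), sum_mul, mul_sum]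
      rw [sum_comm]
      refine sum_congr rfl fun m _ => sum_congr rfl fun a _ => ?_
      rw [show a * -(n - m) = a * -n + a * m by ring, add_mul, AddChar.map_add_eq_mul,
        AddChar.map_add_eq_mul]
      ring
    rw [h]
    simp only [iterConv, convR, mul_sum]
    refine norm_sum_le_of_le _ fun m _ => ?_
    rw [← mul_sum, norm_mul, norm_mul, norm_stdAddChar, mul_one, Complex.norm_real,
      Real.norm_of_nonneg (hf m), mul_left_comm]
    exact mul_le_mul_of_nonneg_left (ih _ _) (hf m)

lemma sum_prod_translates_le {G ι : Type*} [AddGroup G] [Fintype G] [DecidableEq ι]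
    (h : G → ℝ) (h0 : ∀ a, 0 ≤ h a) (M : ℝ) (hM : ∀ a, h a ≤ M) (u : ι → G) (I : Finset ι)
    (hI : 2 ≤ #I) :
    ∑ a, ∏ i ∈ I, h (a + u i) ≤ M ^ (#I - 2) * ∑ a, h a ^ 2 := by
  obtain ⟨i, hi, j, hj, hij⟩ := one_lt_card.1 (by omega : 1 < #I)
  have hj' : j ∈ I.erase i := mem_erase.2 ⟨hij.symm, hj⟩
  have hcard : #((I.erase i).erase j) = #I - 2 := by
    rw [card_erase_of_mem hj', card_erase_of_mem hi]; omega
  have htrans : ∀ v, ∑ a, h (a + v) ^ 2 = ∑ a, h a ^ 2 := fun v =>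
    Equiv.sum_comp (Equiv.addRight v) fun a => h a ^ 2
  have hM0 : 0 ≤ M := (h0 0).trans (hM 0)
  calc ∑ a, ∏ i ∈ I, h (a + u i)
      ≤ ∑ a, M ^ (#I - 2) * ((h (a + u i) ^ 2 + h (a + u j) ^ 2) / 2) := by
        refine sum_le_sum fun a _ => ?_
        rw [← mul_prod_erase I _ hi, ← mul_prod_erase _ _ hj', ← hcard, ← mul_assoc, mul_comm]
        refine mul_le_mul ?_ ?_ (mul_nonneg (h0 _) (h0 _)) (pow_nonneg hM0 _)
        · exact (prod_le_prod (fun l _ => h0 _) fun l _ => hM _).trans_eq (prod_const M)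
        · nlinarith [sq_nonneg (h (a + u i) - h (a + u j))]
    _ = M ^ (#I - 2) * ∑ a, h a ^ 2 := by
        rw [← mul_sum, ← sum_div, sum_add_distrib, htrans, htrans, add_self_div_two]

lemma sum_prod_translates_erase_le {G : Type*} [AddGroup G] [Fintype G] [DecidableEq G]
    (h : G → ℝ) (h0 : ∀ a, 0 ≤ h a) (M : ℝ) (hM : ∀ a, h a ≤ M) (B : Finset G) (ε : ℝ)
    (hε0 : 0 ≤ ε) (hε : ∀ a ∉ B, h a ≤ ε) (t : ℕ) (ht : 3 ≤ t) (u : Fin t → G) (a₀ : G)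
    (hu : ∀ a, (∀ i, a + u i ∈ B) → a = a₀) :
    ∑ a ∈ univ.erase a₀, ∏ i, h (a + u i) ≤ t * (ε * (M ^ (t - 3) * ∑ a, h a ^ 2)) := by
  have hprod0 : ∀ (I : Finset (Fin t)) a, 0 ≤ ∏ i ∈ I, h (a + u i) := fun I a =>
    prod_nonneg fun i _ => h0 _
  calc ∑ a ∈ univ.erase a₀, ∏ i, h (a + u i)
      ≤ ∑ a ∈ univ.erase a₀, ∑ j, ε * ∏ i ∈ univ.erase j, h (a + u i) := by
        refine sum_le_sum fun a ha => ?_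
        have hne : ¬ ∀ i, a + u i ∈ B := fun h => (mem_erase.1 ha).1 (hu a h)
        push Not at hne
        obtain ⟨j, hj⟩ := hne
        refine le_trans ?_ (single_le_sum (f := fun j => ε * ∏ i ∈ univ.erase j, h (a + u i))
          (fun j _ => mul_nonneg hε0 (hprod0 _ a)) (mem_univ j))
        rw [← mul_prod_erase univ _ (mem_univ j)]
        exact mul_le_mul_of_nonneg_right (hε _ hj) (hprod0 _ a)
    _ ≤ ∑ a, ∑ j, ε * ∏ i ∈ univ.erase j, h (a + u i) :=
        sum_le_sum_of_subset_of_nonneg (erase_subset _ _) fun a _ _ =>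
          sum_nonneg fun j _ => mul_nonneg hε0 (hprod0 _ a)
    _ = ∑ j, ε * ∑ a, ∏ i ∈ univ.erase j, h (a + u i) := by
        rw [sum_comm]; simp_rw [mul_sum]
    _ ≤ ∑ _j : Fin t, ε * (M ^ (t - 3) * ∑ a, h a ^ 2) := by
        refine sum_le_sum fun j _ => mul_le_mul_of_nonneg_left ?_ hε0
        have hc : #((univ : Finset (Fin t)).erase j) = t - 1 := by
          rw [card_erase_of_mem (mem_univ j), card_univ, Fintype.card_fin]
        have := sum_prod_translates_le h h0 M hM u (univ.erase j) (by omega)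
        rwa [hc, show t - 1 - 2 = t - 3 by omega] at this
    _ = t * (ε * (M ^ (t - 3) * ∑ a, h a ^ 2)) := by simp

lemma iterConv_nonneg (p : ℕ) [NeZero p] (f : ZMod p → ℝ) (hf : ∀ n, 0 ≤ f n) (s : ℕ)
    (n : ZMod p) : 0 ≤ iterConv p f s n := by
  induction s generalizing n with
  | zero => simp only [iterConv]; split_ifs <;> norm_num
  | succ s ih => exact sum_nonneg fun m _ => mul_nonneg (hf m) (ih _)

/-- **Theorem 2.** If `f : ZMod p → [0,1]` is not identically zero, its Fourier
coefficients are arranged as `λ_i = f̂(a_i)` with `|f̂(a_1)| ≥ ⋯ ≥ |f̂(a_p)|`,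
`θ = p⁻¹ ∑ f(n)`, `t ≥ 3`, and for some
`1 ≤ k < (log p)^(t-1) (5t log log p)^(-2t+2)` one has `|λ_{k+1}| ≤ γ |λ_k|` with
`γ < t⁻¹ θ^(-t+2) (|λ_k|/p)^(t-1)`, then the `t`-fold convolution `f*f*⋯*f` is
strictly positive on all of `ZMod p`.
(Here `a ⟨k-1, _⟩ = a_k` and `a k = a_{k+1}` in 0-based indexing.) -/
theorem spectral_gap_repeated_sumset (p : ℕ) [Fact p.Prime] (t : ℕ) (ht : 3 ≤ t)
    (f : ZMod p → ℝ)
    (hf01 : ∀ n, f n ∈ Set.Icc (0 : ℝ) 1) (hf0 : f ≠ 0)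
    (a : Fin p → ZMod p) (ha : Function.Bijective a)
    (hmono : ∀ i j : Fin p, i ≤ j → ‖dft p f (a j)‖ ≤ ‖dft p f (a i)‖)
    (θ : ℝ) (hθ : θ = (∑ n : ZMod p, f n) / p)
    (k : Fin p) (hk1 : 1 ≤ (k : ℕ))
    (hklt : ((k : ℕ) : ℝ) <
      (Real.log p) ^ (t - 1) *
        (5 * t * Real.log (Real.log p)) ^ ((-2) * (t : ℤ) + 2))
    (γ : ℝ) (hγ : 0 ≤ γ)
    (hgap : ‖dft p f (a k)‖ ≤
      γ * ‖dft p f (a ⟨(k : ℕ) - 1, lt_of_le_of_lt (Nat.sub_le _ _) k.isLt⟩)‖)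
    (hγlt : γ < (t : ℝ)⁻¹ * θ ^ (-(t : ℤ) + 2) *
      (‖dft p f (a ⟨(k : ℕ) - 1, lt_of_le_of_lt (Nat.sub_le _ _) k.isLt⟩)‖ / p) ^ (t - 1)) :
    ∀ n : ZMod p, 0 < iterConv p f t n := by
  set μ := ‖dft p f (a ⟨(k : ℕ) - 1, lt_of_le_of_lt (Nat.sub_le _ _) k.isLt⟩)‖ with hμ
  have hp : p.Prime := Fact.out
  have hp0 : (0 : ℝ) < p := by exact_mod_cast hp.pos
  have ht0 : (0 : ℝ) < t := by positivity
  have hf : ∀ n, 0 ≤ f n := fun n => (hf01 n).1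
  have hμ0 : 0 < μ := by
    refine (norm_nonneg _).lt_of_ne' fun h => ?_
    rw [show μ = 0 from h, zero_div, zero_pow (by omega), mul_zero] at hγlt
    linarith
  have hsum : ∑ n, f n = θ * p := by rw [hθ]; field_simp
  have hθ0 : 0 < θ := by
    have h1 : 0 < ∑ n, f n :=
      hμ0.trans_le (norm_dft_le p f hf _)
    rw [hθ]
    positivity
  set B : Finset (ZMod p) := (univ.filter fun i : Fin p => i < k).image a with hBdef
  have hBcard : #B = k := by
    rw [hBdef, card_image_of_injective _ ha.injective]
    exact (congrArg card (by ext; simp)).trans (Fin.card_Iio k)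
  have hBmem : ∀ b ∈ B, μ ≤ ‖dft p f b‖ := by
    intro b hb
    obtain ⟨i, hi, rfl⟩ := mem_image.1 hb
    refine hmono _ _ ?_
    have : i < k := (mem_filter.1 hi).2
    rw [Fin.le_def]
    have : (i : ℕ) < k := this
    simp only
    omega
  have hBnot : ∀ b ∉ B, ‖dft p f b‖ ≤ γ * μ := by
    intro b hb
    obtain ⟨i, rfl⟩ := ha.surjective b
    refine (hmono k i (not_lt.1 fun hi => hb ?_)).trans hgap
    exact mem_image_of_mem a (by simpa using hi)
  have hkL : ((k : ℕ) : ℝ) <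
      (Real.log p / (5 * t * Real.log (Real.log p)) ^ 2) ^ (t - 1) := by
    rw [div_pow, ← pow_mul, div_eq_mul_inv, ← zpow_natCast (5 * (t : ℝ) * _) (2 * (t - 1)), ← zpow_neg]
    convert hklt using 2
    congr 1
    push_cast [Nat.cast_sub (by omega : 1 ≤ t)]
    ring
  obtain ⟨hL, s, hs1, hs2⟩ := exists_sample_size hp.two_le ht hk1 _ rfl hkL
  have hBne : B.Nonempty := card_pos.1 (by omega)
  rw [← hBcard] at hs1 hs2 hkL
  obtain ⟨r, rfl⟩ : ∃ r, t = r + 3 := ⟨t - 3, by omega⟩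
  obtain ⟨u, a₀, hu⟩ : ∃ (u : Fin (r + 3) → ZMod p) (a₀ : ZMod p),
      ∀ a, (∀ i, a + u i ∈ B) ↔ a = a₀ :=
    exists_unique_translate B hBne _ hL s hs1 hs2 (r + 2) hkL.le
  rw [show r + 3 - 1 = r + 2 by omega] at hγlt
  intro n
  refine (iterConv_nonneg p f hf _ n).lt_of_ne' fun hzero => ?_
  have hW := norm_sum_prod_dft_le p f hf (r + 3) u n
  rw [hzero, mul_zero, norm_le_zero_iff, ← add_sum_erase _ _ (mem_univ a₀)] at hW
  have hlow : μ ^ (r + 3) ≤ ∏ i, ‖dft p f (a₀ + u i)‖ := by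
    have := prod_le_prod (s := (univ : Finset (Fin (r + 3)))) (f := fun _ => μ)
      (fun _ _ => hμ0.le) fun i _ => hBmem _ ((hu a₀).2 rfl i)
    simpa using this
  have hup : ∏ i, ‖dft p f (a₀ + u i)‖ ≤ ∑ b ∈ univ.erase a₀, ∏ i, ‖dft p f (b + u i)‖ := by
    have h1 := congrArg norm (eq_neg_of_add_eq_zero_left hW)
    rw [norm_neg, norm_mul, norm_stdAddChar, one_mul, norm_prod] at h1
    rw [h1]
    refine norm_sum_le_of_le _ fun b _ => ?_
    rw [norm_mul, norm_stdAddChar, one_mul, norm_prod]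
  have herr := sum_prod_translates_erase_le (fun b => ‖dft p f b‖) (fun _ => norm_nonneg _)
    (θ * p) (fun b => hsum ▸ norm_dft_le p f hf b) B (γ * μ) (by positivity) hBnot (r + 3) ht u a₀
    fun b hb => (hu b).1 hb
  have hsq : ∑ b, ‖dft p f b‖ ^ 2 ≤ p * (θ * p) := by
    rw [sum_norm_dft_sq, ← hsum]
    refine mul_le_mul_of_nonneg_left (sum_le_sum fun m _ => ?_) hp0.le
    nlinarith [(hf01 m).1, (hf01 m).2]
  have hfinal : ((r + 3 : ℕ) : ℝ) * (γ * μ * ((θ * p) ^ r * (p * (θ * p)))) < μ ^ (r + 3) := by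
    have hexp : θ ^ (-((r + 3 : ℕ) : ℤ) + 2) = (θ ^ (r + 1))⁻¹ := by
      rw [← zpow_natCast, ← zpow_neg]
      congr 1
    rw [hexp, div_pow] at hγlt
    calc ((r + 3 : ℕ) : ℝ) * (γ * μ * ((θ * p) ^ r * (p * (θ * p))))
        = γ * (((r + 3 : ℕ) : ℝ) * μ * θ ^ (r + 1) * p ^ (r + 2)) := by ring
      _ < (((r + 3 : ℕ) : ℝ)⁻¹ * (θ ^ (r + 1))⁻¹ * (μ ^ (r + 2) / p ^ (r + 2))) *
          (((r + 3 : ℕ) : ℝ) * μ * θ ^ (r + 1) * p ^ (r + 2)) :=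
        mul_lt_mul_of_pos_right hγlt (by positivity)
      _ = μ ^ (r + 3) := by field_simp; ring
  refine absurd (hlow.trans (hup.trans (herr.trans ?_))) (not_le.2 hfinal)
  rw [Nat.add_sub_cancel]
  gcongr
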